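/- arXiv:0803.1317 — 3 statements merged into one kernel-verified Lean document; each statement's English description precedes it below -/
import Mathlib

section
/- For every integer n ≥ 3, the family of Cayley–Menger polynomials (Q_s), indexed by the (n−1)-element subsets s of Fin (n+1), is algebraically independent over ℂ in the multivariate polynomial ring ℂ[x_e : e a 2-element subset of Fin (n+1)]. (This is the squared-volume form of the statement that the (n−2)-dimensional volumes of the (n−2)-dimensional faces of an n-dimensional simplex are algebraically independent functions of the squared edge lengths.) -/
open Matrix Finset

/-- The (n-1)-element subsets of `Fin (n+1)`, indexing the codimension-2 faces
of an `n`-dimensional simplex. -/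
abbrev Faces (n : ℕ) := {s : Finset (Fin (n + 1)) // s.card = n - 1}

/-- The 2-element subsets of `Fin (n+1)`, indexing the edges of an
`n`-dimensional simplex. -/
abbrev Edges (n : ℕ) := {e : Finset (Fin (n + 1)) // e.card = 2}

/-- The Cayley–Menger matrix of a subset `s` of `Fin (n+1)`, with rows and
columns indexed by `{*} ∪ s` (encoded as `Option ↥s`, with `none` the added
basepoint `*`): the diagonal entries are `0`, the entries pairing the basepoint
with an element of `s` are `1`, and the entry for distinct `i, j ∈ s` is the
variable `x_{{i,j}}`. -/
noncomputable def cayleyMengerMatrix (n : ℕ) (s : Finset (Fin (n + 1))) :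
    Matrix (Option {x // x ∈ s}) (Option {x // x ∈ s}) (MvPolynomial (Edges n) ℂ) :=
  fun i j =>
    match i, j with
    | none, none => 0
    | none, some _ => 1
    | some _, none => 1
    | some a, some b =>
      if h : a = b then 0
      else MvPolynomial.X ⟨{a.val, b.val}, Finset.card_pair fun hab => h (Subtype.ext hab)⟩

/-- The Cayley–Menger polynomial `Q_s` of an (n-1)-element subset `s` of
`Fin (n+1)`: the determinant of the Cayley–Menger matrix of `s`.  If the
variables `x_e` are interpreted as squared edge lengths of a simplex with
vertex set `Fin (n+1)`, then `Q_s` equals, up to a nonzero constant, the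
squared `(n-2)`-dimensional volume of the face with vertex set `s`. -/
noncomputable def Q (n : ℕ) (s : Faces n) : MvPolynomial (Edges n) ℂ :=
  (cayleyMengerMatrix n s.val).det

/-- Chain rule for a derivation applied to a polynomial expression. -/
theorem chainRule_aeval {ι A : Type*} [Fintype ι] [CommRing A] [Algebra ℂ A]
    (D : Derivation ℂ A A) (g : ι → A) (p : MvPolynomial ι ℂ) :
    D (MvPolynomial.aeval g p) =
      ∑ i, MvPolynomial.aeval g (MvPolynomial.pderiv i p) * D (g i) := by
  classical
  induction p using MvPolynomial.induction_on with
  | C a => simp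
  | add p q hp hq => simp [hp, hq, add_mul, Finset.sum_add_distrib]
  | mul_X p j hp =>
    simp only [map_mul, MvPolynomial.aeval_X, Derivation.leibniz, smul_eq_mul, hp,
      MvPolynomial.pderiv_X, map_add, add_mul, Finset.sum_add_distrib]
    congr 1
    · rw [Finset.sum_eq_single j]
      · simp
      · intro b _ hb
        simp [hb.symm]
      · simp
    · rw [Finset.mul_sum]
      exact Finset.sum_congr rfl fun i _ => by ring

theorem totalDegree_pderiv_lt' {ι : Type*} (P : MvPolynomial ι ℂ) (i : ι) (d : ℕ)
    (hd : P.totalDegree ≤ d + 1) : (MvPolynomial.pderiv i P).totalDegree ≤ d := by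
  classical
  refine Finset.sup_le fun m hm => ?_
  rw [MvPolynomial.mem_support_iff, MvPolynomial.coeff_pderiv] at hm
  have h1 := MvPolynomial.le_totalDegree (MvPolynomial.mem_support_iff.mpr (left_ne_zero_of_mul hm))
  rw [Finsupp.sum_add_index' (fun _ => rfl) (fun _ _ _ => rfl), Finsupp.sum_single_index rfl] at h1
  omega

theorem eq_C_of_pderiv_zero {ι : Type*} (P : MvPolynomial ι ℂ)
    (h : ∀ i, MvPolynomial.pderiv i P = 0) : P = MvPolynomial.C (MvPolynomial.coeff 0 P) := by
  classical
  ext m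
  rw [MvPolynomial.coeff_C]
  split_ifs with hm
  · rw [← hm]
  · obtain ⟨i, hi⟩ : ∃ i, m i ≠ 0 := by
      by_contra hc
      push Not at hc
      exact hm (Finsupp.ext fun i => (hc i).symm)
    have h1 := congrArg (MvPolynomial.coeff (m - Finsupp.single i 1)) (h i)
    rw [MvPolynomial.coeff_pderiv] at h1
    have hle : Finsupp.single i 1 ≤ m := by
      rw [Finsupp.single_le_iff]; omega
    rw [tsub_add_cancel_of_le hle] at h1
    simp only [MvPolynomial.coeff_zero, mul_eq_zero] at h1
    rcases h1 with h1 | h1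
    · exact h1
    · exact absurd h1 (Nat.cast_add_one_ne_zero _)

/-- The Jacobian criterion. -/
theorem jacobian_criterion {ι σ : Type*} [Fintype ι] [Fintype σ]
    (hcard : Fintype.card ι = Fintype.card σ)
    (q : ι → MvPolynomial σ ℂ) (x : σ → ℂ)
    (h : ∀ f : σ → ℂ,
      (∀ i, ∑ e, MvPolynomial.eval x (MvPolynomial.pderiv e (q i)) * f e = 0) → f = 0) :
    AlgebraicIndependent ℂ q := by
  classical
  let E : σ ≃ ι := (Fintype.equivOfCardEq hcard).symm
  let J : Matrix σ σ (MvPolynomial σ ℂ) := fun t e => MvPolynomial.pderiv e (q (E t))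
  have hdet : J.det ≠ 0 := by
    intro h0
    have h1 : ((MvPolynomial.eval x).mapMatrix J).det = 0 := by
      rw [← RingHom.map_det, h0, map_zero]
    obtain ⟨v, hv, hv0⟩ := Matrix.exists_mulVec_eq_zero_iff.mpr h1
    apply hv
    apply h
    intro i
    have := congrFun hv0 (E.symm i)
    change ∑ e, MvPolynomial.eval x (MvPolynomial.pderiv e (q (E (E.symm i)))) * v e = 0 at this
    simpa only [Equiv.apply_symm_apply] using this
  have key : ∀ d : ℕ, ∀ P : MvPolynomial ι ℂ, P.totalDegree ≤ d →
      MvPolynomial.aeval q P = 0 → P = 0 := by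
    have hconst : ∀ P : MvPolynomial ι ℂ, P = MvPolynomial.C (MvPolynomial.coeff 0 P) →
        MvPolynomial.aeval q P = 0 → P = 0 := by
      intro P hP h0
      rw [hP] at h0 ⊢
      simpa using h0
    intro d
    induction d with
    | zero =>
      intro P hP h0
      exact hconst P (MvPolynomial.totalDegree_eq_zero_iff_eq_C.mp (by omega)) h0
    | succ d ih =>
      intro P hP h0
      refine hconst P (eq_C_of_pderiv_zero P fun i => ?_) h0
      refine ih _ (totalDegree_pderiv_lt' P i d hP) ?_
      have hv : (fun t => MvPolynomial.aeval q (MvPolynomial.pderiv (E t) P)) ᵥ* J = 0 := by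
        funext e
        have := chainRule_aeval (MvPolynomial.pderiv e) q P
        rw [h0, map_zero, ← E.sum_comp] at this
        simpa [Matrix.vecMul, dotProduct, J] using this.symm
      have := congrFun (Matrix.eq_zero_of_vecMul_eq_zero hdet hv) (E.symm i)
      simpa using this
  rw [algebraicIndependent_iff]
  intro P hP
  exact key _ P le_rfl hP

/-- The combinatorial core: inclusion of 2-subsets in (n-1)-subsets is nonsingular. -/
theorem pair_inclusion_injective (n : ℕ) (hn : 3 ≤ n) (F : Fin (n + 1) → Fin (n + 1) → ℂ)
    (hs : ∀ a b, F a b = F b a) (hd : ∀ a, F a a = 0)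
    (h : ∀ s : Finset (Fin (n + 1)), s.card = n - 1 → ∑ a ∈ s, ∑ b ∈ s, F a b = 0) :
    ∀ a b, F a b = 0 := by
  classical
  set d : Fin (n + 1) → ℂ := fun a => ∑ b, F a b with hdd
  set T : ℂ := ∑ a, d a with hT
  have hn0 : (n : ℂ) - 2 ≠ 0 := by
    intro hc
    have : (n : ℂ) = (2 : ℕ) := by push_cast; linear_combination hc
    have := Nat.cast_injective this
    omega
  have hn1 : (n : ℂ) - 1 ≠ 0 := by
    intro hc
    have : (n : ℂ) = (1 : ℕ) := by push_cast; linear_combination hc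
    have := Nat.cast_injective this
    omega
  have key : ∀ p q, p ≠ q → 2 * F p q = 2 * d p + 2 * d q - T := by
    intro p q hpq
    have hc : ((univ.erase p).erase q).card = n - 1 := by
      rw [Finset.card_erase_of_mem (by simp [hpq.symm]), Finset.card_erase_of_mem (by simp)]
      simp
    have h1 := h _ hc
    have er : ∀ g : Fin (n + 1) → ℂ,
        ∑ a ∈ (univ.erase p).erase q, g a = ∑ a, g a - g p - g q := by
      intro g
      rw [Finset.sum_erase_eq_sub (by simp [hpq.symm]), Finset.sum_erase_eq_sub (by simp)]
    simp only [er, Finset.sum_sub_distrib] at h1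
    have c1 : ∀ r, ∑ a, F a r = d r := fun r => Finset.sum_congr rfl fun a _ => hs a r
    have hT' : ∑ a, ∑ b, F a b = T := rfl
    have hp' : ∑ b, F p b = d p := rfl
    have hq' : ∑ b, F q b = d q := rfl
    rw [c1, c1, hT', hp', hq', hd, hd, hs q p] at h1
    linear_combination h1
  have hdT : ∀ p, 2 * d p = T := by
    intro p
    have e1 : 2 * d p = ∑ q ∈ univ.erase p, (2 * d p + 2 * d q - T) := by
      have : d p = ∑ q ∈ univ.erase p, F p q := by
        rw [Finset.sum_erase_eq_sub (by simp), hd, sub_zero]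
      conv_lhs => rw [this, Finset.mul_sum]
      refine Finset.sum_congr rfl fun q hq => ?_
      exact key p q (Finset.ne_of_mem_erase hq).symm
    rw [Finset.sum_erase_eq_sub (by simp)] at e1
    simp only [Finset.sum_sub_distrib, Finset.sum_add_distrib, ← Finset.mul_sum, ← hT] at e1
    simp at e1
    apply mul_left_cancel₀ hn0
    linear_combination -e1
  have hT0 : T = 0 := by
    have : 2 * T = (n + 1) * T := by
      conv_lhs => rw [hT, Finset.mul_sum]
      simp [hdT]
    apply mul_left_cancel₀ hn1
    linear_combination -this
  intro a b
  by_cases hab : a = b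
  · rw [hab, hd]
  · have := key a b hab
    rw [hdT, hdT, hT0] at this
    simpa using this

/-- The derivative of the determinant at `J - I`. -/
theorem deriv_det_aux {κ : Type*} [Fintype κ] [DecidableEq κ] (m : ℕ)
    (hm : Fintype.card κ = m + 1) (hm0 : m ≠ 0) (G : Matrix κ κ ℂ) (hG : ∀ i, G i i = 0)
    (h : (Polynomial.derivative (Matrix.det
      ((Matrix.of (fun i j : κ => if i = j then (0 : ℂ) else 1)).map Polynomial.C
        + (Polynomial.X : Polynomial ℂ) • G.map Polynomial.C))).eval 0 = 0) :
    ∑ i, ∑ j, G i j = 0 := by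
  have hmC : (m : ℂ) ≠ 0 := by exact_mod_cast hm0
  set M : Matrix κ κ ℂ := Matrix.of (fun i j : κ => if i = j then (0 : ℂ) else 1) with hM
  set N : Matrix κ κ ℂ := Matrix.of (fun i j : κ => (m : ℂ)⁻¹ - if i = j then (1 : ℂ) else 0) with hN
  have hM' : ∀ i j, M i j = 1 - if i = j then (1 : ℂ) else 0 := by
    intro i j; simp only [hM, Matrix.of_apply]; split_ifs <;> simp
  have hMN : M * N = 1 := by
    ext i j
    rw [Matrix.mul_apply]
    simp only [hM', hN, Matrix.of_apply, sub_mul, mul_sub, Finset.sum_sub_distrib, one_mul]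
    simp [hm, Matrix.one_apply]
    field_simp
    ring
  have hdetM : M.det ≠ 0 := by
    intro h0
    have := congrArg Matrix.det hMN
    rw [Matrix.det_mul, h0] at this
    simp at this
  have e : M.map Polynomial.C + (Polynomial.X : Polynomial ℂ) • G.map Polynomial.C
      = M.map Polynomial.C * (1 + (Polynomial.X : Polynomial ℂ) • (N * G).map Polynomial.C) := by
    rw [Matrix.mul_add, Matrix.mul_one, Matrix.mul_smul, ← Matrix.map_mul, ← Matrix.mul_assoc,
      hMN, Matrix.one_mul]
  have e2 : (M.map Polynomial.C).det = Polynomial.C M.det := (RingHom.map_det Polynomial.C M).symm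
  rw [e, Matrix.det_mul, e2, Polynomial.derivative_C_mul, Polynomial.eval_C_mul,
    Matrix.derivative_det_one_add_X_smul] at h
  have h1 := (mul_eq_zero.mp h).resolve_left hdetM
  simp only [Matrix.trace, Matrix.diag, Matrix.mul_apply, hN, Matrix.of_apply, sub_mul,
    Finset.sum_sub_distrib, ← Finset.mul_sum] at h1
  simp [hG] at h1
  refine Finset.sum_comm.trans ?_
  exact h1.resolve_left hm0

/-- The Cayley–Menger polynomial along a line through the regular simplex. -/
theorem aeval_Q_line (n : ℕ) (f : Edges n → ℂ) (F : Fin (n + 1) → Fin (n + 1) → ℂ)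
    (hF0 : ∀ a, F a a = 0) (hF1 : ∀ a b (h : a ≠ b), F a b = f ⟨{a, b}, Finset.card_pair h⟩)
    (s : Finset (Fin (n + 1))) (hs : s.card = n - 1)
    (G : Matrix (Option {x // x ∈ s}) (Option {x // x ∈ s}) ℂ)
    (hG0 : ∀ j, G none j = 0) (hG1 : ∀ i, G i none = 0)
    (hG2 : ∀ a b, G (some a) (some b) = F a b) :
    (MvPolynomial.aeval fun e => (1 + Polynomial.X * Polynomial.C (f e) : Polynomial ℂ))
      (Q n ⟨s, hs⟩) = Matrix.det
        ((Matrix.of (fun i j : Option {x // x ∈ s} => if i = j then (0 : ℂ) else 1)).map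
          Polynomial.C + (Polynomial.X : Polynomial ℂ) • G.map Polynomial.C) := by
  change MvPolynomial.aeval _ (cayleyMengerMatrix n s).det = _
  rw [AlgHom.map_det]
  congr 1
  ext1 i j
  rcases i with _ | a <;> rcases j with _ | b
  · simp [cayleyMengerMatrix, hG0]
  · simp [cayleyMengerMatrix, hG0]
  · simp [cayleyMengerMatrix, hG1]
  · by_cases hab : a = b
    · simp [cayleyMengerMatrix, hG2, hab, hF0]
    · have hab' : (a : Fin (n + 1)) ≠ b := fun h => hab (Subtype.ext h)
      simp [cayleyMengerMatrix, hG2, hab, hF1 _ _ hab']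

theorem deriv_line {σ : Type*} [Fintype σ] (f : σ → ℂ) (p : MvPolynomial σ ℂ) :
    (Polynomial.derivative ((MvPolynomial.aeval fun e =>
      (1 + Polynomial.X * Polynomial.C (f e) : Polynomial ℂ)) p)).eval 0 =
      ∑ e, MvPolynomial.eval (fun _ => 1) (MvPolynomial.pderiv e p) * f e := by
  set g : σ → Polynomial ℂ := fun e => 1 + Polynomial.X * Polynomial.C (f e) with hg
  have h0 : ∀ p : MvPolynomial σ ℂ, Polynomial.eval 0 (MvPolynomial.aeval g p)
      = MvPolynomial.eval (fun _ => 1) p := by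
    intro p
    induction p using MvPolynomial.induction_on with
    | C a => simp
    | add p q hp hq => simp [hp, hq]
    | mul_X p j hp => rw [map_mul, map_mul, Polynomial.eval_mul, hp]; simp [g]
  have hdet := chainRule_aeval (Polynomial.derivative' (R := ℂ)) g p
  have h1 : Polynomial.derivative (MvPolynomial.aeval g p) =
    ∑ e, MvPolynomial.aeval g (MvPolynomial.pderiv e p) * Polynomial.derivative (g e) := hdet
  rw [h1, Polynomial.eval_finsetSum]
  refine Finset.sum_congr rfl fun e _ => ?_
  rw [Polynomial.eval_mul, h0]
  congr 1
  simp [g]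

/-- For every `n ≥ 3`, the family of Cayley–Menger polynomials `Q_s`, indexed
by the (n-1)-element subsets `s` of `Fin (n+1)`, is algebraically independent
over `ℂ` in `ℂ[x_e : e a 2-element subset of Fin (n+1)]`. -/
theorem cayleyMenger_algebraicIndependent (n : ℕ) (hn : 3 ≤ n) :
    AlgebraicIndependent ℂ (Q n) := by
  classical
  apply jacobian_criterion (x := fun _ => 1)
  · rw [Fintype.card_finset_len, Fintype.card_finset_len, Fintype.card_fin]
    exact Nat.choose_symm_of_eq_add (by omega)
  intro f hf
  let F : Fin (n + 1) → Fin (n + 1) → ℂ := fun a b =>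
    if h : a = b then 0 else f ⟨{a, b}, Finset.card_pair h⟩
  have hF0 : ∀ a, F a a = 0 := fun a => by simp [F]
  have hF1 : ∀ a b (h : a ≠ b), F a b = f ⟨{a, b}, Finset.card_pair h⟩ :=
    fun a b h => dif_neg h
  have hF : ∀ a b, F a b = 0 := by
    apply pair_inclusion_injective n hn
    · intro a b
      by_cases hab : a = b
      · rw [hab]
      · have hba : ¬ b = a := fun h => hab h.symm
        simp only [F, hab, hba, dif_neg, not_false_eq_true]
        congr 2
        exact Finset.pair_comm a b
    · intro a; simp [F]
    intro s hs
    obtain ⟨G, hG0, hG1, hG2⟩ : ∃ G : Matrix (Option {x // x ∈ s}) (Option {x // x ∈ s}) ℂ,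
        (∀ j, G none j = 0) ∧ (∀ i, G i none = 0) ∧ ∀ a b, G (some a) (some b) = F a b := by
      refine ⟨Matrix.of fun i j => i.elim 0 fun a => j.elim 0 fun b => F a b, ?_, ?_, ?_⟩
      · intro j; rfl
      · rintro (_ | a) <;> rfl
      · intro a b; rfl
    have e1 := aeval_Q_line n f F hF0 hF1 s hs G hG0 hG1 hG2
    have e2 := (deriv_line f (Q n ⟨s, hs⟩)).trans (hf ⟨s, hs⟩)
    rw [e1] at e2
    have hcard : Fintype.card (Option {x // x ∈ s}) = (n - 1) + 1 := by simp [hs]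
    have hdiag : ∀ i, G i i = 0 := by rintro (_ | a) <;> simp [hG0, hG2, hF0]
    have h2 := deriv_det_aux (n - 1) hcard (by omega) G hdiag e2
    simp only [Fintype.sum_option, hG0, hG1, hG2, Finset.sum_const_zero, zero_add] at h2
    rw [← Finset.sum_coe_sort]
    rw [← h2]
    refine Finset.sum_congr rfl fun a _ => ?_
    exact (Finset.sum_coe_sort s (fun b => F a b)).symm
  funext e
  obtain ⟨e, he⟩ := e
  obtain ⟨a, b, hab, rfl⟩ := Finset.card_eq_two.mp he
  have := hF a b
  simpa [F, hab] using this
end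

section
/- For every integer n ≥ 3, the matrix M is invertible (as a square matrix over ℝ, or equivalently over ℚ). -/
open Matrix Finset

/-- The face-edge incidence matrix: `M s e = 1` if the edge `e` is contained in
the face `s`, and `0` otherwise. -/
def M (n : ℕ) : Matrix (Faces n) (Edges n) ℝ :=
  fun s e => if e.val ⊆ s.val then 1 else 0

theorem M_core (n : ℕ) (hn : 3 ≤ n) (f : Edges n → ℝ)
    (h : ∀ s : Faces n, ∑ e : Edges n, (if e.val ⊆ s.val then f e else 0) = 0) : f = 0 := by
  obtain ⟨d, hd⟩ : ∃ d : Fin (n+1) → ℝ, ∀ a, d a = ∑ e : Edges n, if a ∈ e.val then f e else 0 :=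
    ⟨_, fun _ => rfl⟩
  obtain ⟨T, hT⟩ : ∃ T : ℝ, T = ∑ e : Edges n, f e := ⟨_, rfl⟩
  have h1 : ∀ a b, a ≠ b →
      (∑ e : Edges n, if e.val = {a, b} then f e else 0) = d a + d b - T := by
    intro a b hab
    have hc : (({a, b} : Finset (Fin (n+1)))ᶜ).card = n - 1 := by
      rw [card_compl, card_pair hab, Fintype.card_fin]; omega
    have := h ⟨_, hc⟩
    have h2 : ∑ e : Edges n, (if e.val ⊆ ({a, b} : Finset (Fin (n+1)))ᶜ then f e else 0)
        = ∑ e : Edges n, (f e - (if a ∈ e.val then f e else 0) - (if b ∈ e.val then f e else 0)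
          + (if e.val = {a, b} then f e else 0)) := by
      apply sum_congr rfl
      rintro ⟨e, he⟩ -
      have k1 : e ⊆ ({a, b} : Finset (Fin (n+1)))ᶜ ↔ a ∉ e ∧ b ∉ e := by
        rw [subset_compl_comm]
        simp [insert_subset_iff]
      have k2 : e = {a, b} ↔ a ∈ e ∧ b ∈ e := by
        constructor
        · rintro rfl; simp
        · rintro ⟨ha, hb⟩
          symm
          apply eq_of_subset_of_card_le
          · simp [insert_subset_iff, ha, hb]
          · rw [he, card_pair hab]
      simp only [k1, k2]
      by_cases ha : a ∈ e <;> by_cases hb : b ∈ e <;> simp [ha, hb]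
    rw [sum_add_distrib, sum_sub_distrib, sum_sub_distrib, ← hd, ← hd, ← hT] at h2
    simp only [] at this
    linarith
  have h3 : ∀ a, ∑ b ∈ univ.erase a, (∑ e : Edges n, if e.val = {a, b} then f e else 0) = d a := by
    intro a
    rw [sum_comm, hd]
    apply sum_congr rfl
    rintro ⟨e, he⟩ -
    by_cases ha : a ∈ e
    · obtain ⟨c, hc, rfl⟩ : ∃ c, c ≠ a ∧ e = {a, c} := by
        obtain ⟨x, y, hxy, rfl⟩ := card_eq_two.1 he
        simp only [mem_insert, mem_singleton] at ha
        rcases ha with rfl | rfl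
        · exact ⟨y, hxy.symm, rfl⟩
        · exact ⟨x, hxy, pair_comm _ _⟩
      rw [sum_eq_single c]
      · simp
      · intro b hb hbc
        rw [if_neg]
        intro hh
        have : c ∈ ({a, b} : Finset (Fin (n+1))) := by
          rw [← hh]; simp
        simp only [mem_insert, mem_singleton] at this
        rcases this with h | h
        · exact hc h
        · exact hbc h.symm
      · intro hh; simp [hc] at hh
    · simp only [ha, if_false]
      apply sum_eq_zero
      intro b _
      rw [if_neg]
      rintro rfl
      simp at ha
  have h4 : ∑ a, d a = 2 * T := by
    simp_rw [hd]
    rw [sum_comm, hT, mul_sum]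
    apply sum_congr rfl
    rintro ⟨e, he⟩ -
    simp [he]
  have hN : (3:ℝ) ≤ n := by exact_mod_cast hn
  have h5 : ∀ a, d a = T := by
    intro a
    have h6 := h3 a
    rw [sum_congr rfl (fun b hb => h1 a b (ne_of_mem_erase hb).symm)] at h6
    have h7 := add_sum_erase univ (fun b => d a + d b - T) (mem_univ a)
    rw [h6, sum_sub_distrib, sum_add_distrib, h4] at h7
    simp at h7
    have : ((n:ℝ) - 2) * (d a - T) = 0 := by linarith
    rcases mul_eq_zero.1 this with h | h <;> linarith
  have h8 : T = 0 := by
    simp [h5] at h4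
    rcases h4 with h | h <;> linarith
  funext ⟨e, he⟩
  obtain ⟨x, y, hxy, rfl⟩ := card_eq_two.1 he
  have h9 := h1 x y hxy
  rw [h5, h5, h8, sum_eq_single ⟨{x, y}, he⟩] at h9
  · simpa using h9
  · intro b _ hb
    rw [if_neg]
    intro hh
    exact hb (Subtype.ext hh)
  · simp

/-- For every `n ≥ 3`, the incidence matrix `M` is invertible (as a square
matrix, after identifying the row and column index sets, which have the same
cardinality, by any bijection). -/
theorem M_isUnit (n : ℕ) (hn : 3 ≤ n) (σ : Faces n ≃ Edges n) :
    IsUnit ((M n).submatrix id ⇑σ) := by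
  rw [← Matrix.mulVec_injective_iff_isUnit]
  have key : ∀ v, ((M n).submatrix id ⇑σ) *ᵥ v = 0 → v = 0 := by
    intro v hv
    have := M_core n hn (fun e => v (σ.symm e)) (by
      intro s
      have h := congrFun hv s
      simp only [Matrix.mulVec, dotProduct, Matrix.submatrix_apply, M, id, Pi.zero_apply,
        ite_mul, one_mul, zero_mul] at h
      rw [← Equiv.sum_comp σ]
      simpa using h)
    funext s
    simpa using congrFun this (σ s)
  intro v w hvw
  refine sub_eq_zero.1 (key _ ?_)
  rw [Matrix.mulVec_sub]
  exact sub_eq_zero.2 hvw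
end

section
/- Fix an integer n ≥ 4 and an (n−1)-element subset s₀ of Fin (n+1). Partition the (n−1)-element subsets of Fin (n+1) into three classes: X₁ = {s₀}, X₂ = {s : |s ∩ s₀| = n−2}, and X₃ = {s : |s ∩ s₀| = n−3}. Then for all i, j ∈ {1,2,3} and every s ∈ X_i, the sum Σ_{t ∈ X_j} N_{s,t} equals D_{i,j}, where D is the 3×3 rational matrix with rows: first row ((n−2)(n−1)/2, (n−3)(n−2)(n−1), (n−4)(n−3)(n−2)(n−1)/4); second row ((n−3)(n−2)/2, n³−7n²+17n−14, (n⁴−10n³+39n²−70n+48)/4); third row ((n−4)(n−3)/2, n³−8n²+23n−24, (n⁴−10n³+43n²−90n+76)/4). In other words, D is a front divisor of the weighted graph with adjacency matrix N. -/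
open Matrix Finset

/-- The partition of the (n-1)-element subsets of `Fin (n+1)` into three
classes relative to a fixed subset `s₀`: the class `X 0 = {s₀}`, the class
`X 1` of those `s` with `|s ∩ s₀| = n - 2`, and the class `X 2` of those `s`
with `|s ∩ s₀| = n - 3`. -/
def classes (n : ℕ) (s₀ : Faces n) : Fin 3 → Finset (Faces n)
  | 0 => {s₀}
  | 1 => univ.filter fun s => (s.val ∩ s₀.val).card = n - 2
  | 2 => univ.filter fun s => (s.val ∩ s₀.val).card = n - 3

/-- The `3 × 3` front-divisor matrix `D`. -/
def D (n : ℕ) : Matrix (Fin 3) (Fin 3) ℚ :=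
  !![((n : ℚ) - 2) * ((n : ℚ) - 1) / 2,
     ((n : ℚ) - 3) * ((n : ℚ) - 2) * ((n : ℚ) - 1),
     ((n : ℚ) - 4) * ((n : ℚ) - 3) * ((n : ℚ) - 2) * ((n : ℚ) - 1) / 4;
     ((n : ℚ) - 3) * ((n : ℚ) - 2) / 2,
     (n : ℚ) ^ 3 - 7 * (n : ℚ) ^ 2 + 17 * (n : ℚ) - 14,
     ((n : ℚ) ^ 4 - 10 * (n : ℚ) ^ 3 + 39 * (n : ℚ) ^ 2 - 70 * (n : ℚ) + 48) / 4;
     ((n : ℚ) - 4) * ((n : ℚ) - 3) / 2,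
     (n : ℚ) ^ 3 - 8 * (n : ℚ) ^ 2 + 23 * (n : ℚ) - 24,
     ((n : ℚ) ^ 4 - 10 * (n : ℚ) ^ 3 + 43 * (n : ℚ) ^ 2 - 90 * (n : ℚ) + 76) / 4]

lemma count_faces (n : ℕ) (S : Finset (Fin (n + 1))) :
    (∑ t : Faces n, if S ⊆ t.valᶜ then (1 : ℝ) else 0) = ((n + 1 - S.card).choose (n - 1) : ℕ) := by
  have h1 : (∑ t : Faces n, if S ⊆ t.valᶜ then (1 : ℝ) else 0)
      = ∑ t ∈ Finset.powersetCard (n - 1) (univ : Finset (Fin (n + 1))),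
          if S ⊆ tᶜ then (1 : ℝ) else 0 := by
    symm
    apply Finset.sum_subtype
    intro x
    simp [Finset.mem_powersetCard]
  rw [h1, Finset.sum_boole]
  have h2 : (Finset.powersetCard (n - 1) (univ : Finset (Fin (n + 1)))).filter (fun t => S ⊆ tᶜ)
      = Finset.powersetCard (n - 1) Sᶜ := by
    ext t
    simp only [mem_filter, mem_powersetCard, subset_univ, true_and]
    rw [Finset.subset_compl_comm, and_comm]
  rw [h2, Finset.card_powersetCard, Finset.card_compl, Fintype.card_fin]

/-- number of common missing vertices -/
def kk (n : ℕ) (s t : Faces n) : ℕ := (s.valᶜ ∩ t.valᶜ).card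

lemma kk_comm (n : ℕ) (s t : Faces n) : kk n s t = kk n t s := by
  unfold kk; rw [Finset.inter_comm]

lemma card_c (n : ℕ) (hn : 4 ≤ n) (s : Faces n) : (s.valᶜ).card = 2 := by
  rw [Finset.card_compl, Fintype.card_fin, s.2]; omega

lemma kk_self (n : ℕ) (hn : 4 ≤ n) (s : Faces n) : kk n s s = 2 := by
  unfold kk; rw [Finset.inter_self, card_c n hn]

lemma kk_le (n : ℕ) (hn : 4 ≤ n) (s t : Faces n) : kk n s t ≤ 2 := by
  rw [← card_c n hn s]; exact Finset.card_le_card Finset.inter_subset_left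

lemma kk_two (n : ℕ) (hn : 4 ≤ n) (s t : Faces n) : kk n s t = 2 ↔ s = t := by
  constructor
  · intro h
    have h1 : s.valᶜ ∩ t.valᶜ = s.valᶜ :=
      Finset.eq_of_subset_of_card_le Finset.inter_subset_left (by rw [card_c n hn s]; exact h.ge)
    have h2 : s.valᶜ ∩ t.valᶜ = t.valᶜ :=
      Finset.eq_of_subset_of_card_le Finset.inter_subset_right (by rw [card_c n hn t]; exact h.ge)
    exact Subtype.ext (compl_injective (h1.symm.trans h2))
  · rintro rfl; exact kk_self n hn s

lemma kk_inter (n : ℕ) (hn : 4 ≤ n) (s t : Faces n) :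
    (s.val ∩ t.val).card + 3 = n + kk n s t := by
  have h1 : (s.val ∩ t.val).card + (s.val ∩ t.val)ᶜ.card = n + 1 := by
    rw [Finset.card_add_card_compl, Fintype.card_fin]
  have h2 := Finset.card_union_add_card_inter s.valᶜ t.valᶜ
  rw [Finset.compl_inter] at h1
  rw [card_c n hn, card_c n hn] at h2
  unfold kk
  omega

lemma kk_sum (n : ℕ) (s t : Faces n) :
    (kk n s t : ℝ) = ∑ v ∈ s.valᶜ, if v ∈ t.valᶜ then (1 : ℝ) else 0 := by
  rw [Finset.sum_boole, Finset.filter_mem_eq_inter]; rfl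

lemma sum_one (n : ℕ) (hn : 4 ≤ n) : (∑ _t : Faces n, (1 : ℝ)) = (n + 1) * n / 2 := by
  have h := count_faces n ∅
  simp only [Finset.empty_subset, if_true, Finset.card_empty, Nat.sub_zero] at h
  rw [h, Nat.choose_symm_of_eq_add (show n + 1 = (n - 1) + 2 by omega), Nat.cast_choose_two]
  push_cast; ring

lemma sum_v (n : ℕ) (hn : 4 ≤ n) (v : Fin (n + 1)) :
    (∑ t : Faces n, if v ∈ t.valᶜ then (1 : ℝ) else 0) = n := by
  have h := count_faces n {v}
  simp only [Finset.singleton_subset_iff, Finset.card_singleton, Nat.add_sub_cancel] at h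
  rw [h, Nat.choose_symm_of_eq_add (show n = (n - 1) + 1 by omega), Nat.choose_one_right]

lemma sum_vw (n : ℕ) (hn : 4 ≤ n) (v w : Fin (n + 1)) :
    (∑ t : Faces n, (if v ∈ t.valᶜ then (1 : ℝ) else 0) * (if w ∈ t.valᶜ then (1 : ℝ) else 0))
      = 1 + (n - 1) * (if v = w then 1 else 0) := by
  by_cases hvw : v = w
  · subst hvw
    rw [if_pos rfl]
    have := sum_v n hn v
    calc _ = ∑ t : Faces n, (if v ∈ t.valᶜ then (1 : ℝ) else 0) := by
          apply Finset.sum_congr rfl; intro t _; split_ifs <;> simp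
      _ = _ := by rw [this]; ring
  · rw [if_neg hvw]
    have h := count_faces n {v, w}
    rw [Finset.card_pair hvw, show n + 1 - 2 = n - 1 by omega, Nat.choose_self] at h
    rw [mul_zero, add_zero]
    refine Eq.trans ?_ (h.trans Nat.cast_one)
    apply Finset.sum_congr rfl; intro t _
    simp only [Finset.insert_subset_iff, Finset.singleton_subset_iff]
    by_cases h1 : v ∈ t.valᶜ <;> by_cases h2 : w ∈ t.valᶜ <;> simp [h1, h2]

lemma sum_kk (n : ℕ) (hn : 4 ≤ n) (s : Faces n) : (∑ t : Faces n, (kk n s t : ℝ)) = 2 * n := by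
  simp_rw [kk_sum]
  rw [Finset.sum_comm]
  simp_rw [sum_v n hn]
  rw [Finset.sum_const, card_c n hn]; simp

lemma sum_kkkk (n : ℕ) (hn : 4 ≤ n) (s r : Faces n) :
    (∑ t : Faces n, (kk n r t : ℝ) * kk n s t) = 4 + (n - 1) * kk n s r := by
  simp_rw [kk_sum n _ _, Finset.sum_mul_sum]
  rw [Finset.sum_comm]
  simp_rw [Finset.sum_comm (s := (univ : Finset (Faces n))), sum_vw n hn]
  simp_rw [Finset.sum_add_distrib, ← Finset.mul_sum]
  simp only [Finset.sum_const, card_c n hn]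
  rw [Finset.sum_comm]
  simp only [Finset.sum_ite_eq']
  norm_num

lemma N_eq (n : ℕ) (hn : 4 ≤ n) (s t : Faces n) :
    (M n * (M n)ᵀ) s t
      = ((n : ℝ) - 3) * (n - 4) / 2 + (n - 3) * kk n s t + (if s = t then 1 else 0) := by
  have h0 : (M n * (M n)ᵀ) s t = ((s.val ∩ t.val).card.choose 2 : ℕ) := by
    rw [Matrix.mul_apply]
    have h1 : ∀ e : Edges n, M n s e * (M n)ᵀ e t
        = if e.val ⊆ s.val ∩ t.val then (1 : ℝ) else 0 := by
      intro e
      simp only [M, Matrix.transpose_apply, Finset.subset_inter_iff]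
      by_cases h1 : e.val ⊆ s.val <;> by_cases h2 : e.val ⊆ t.val <;> simp [h1, h2]
    simp_rw [h1]
    have h2 : (∑ e : Edges n, if e.val ⊆ s.val ∩ t.val then (1 : ℝ) else 0)
      = ∑ e ∈ Finset.powersetCard 2 (univ : Finset (Fin (n + 1))),
          if e ⊆ s.val ∩ t.val then (1 : ℝ) else 0 := by
      symm
      apply Finset.sum_subtype
      intro x
      simp [Finset.mem_powersetCard]
    rw [h2, Finset.sum_boole, ← Finset.card_powersetCard]
    congr 2
    ext e
    simp only [mem_filter, mem_powersetCard, subset_univ, true_and]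
    rw [and_comm]
  have h3 := kk_inter n hn s t
  have h4 : (((s.val ∩ t.val).card : ℕ) : ℝ) = n + kk n s t - 3 := by
    rw [eq_sub_iff_add_eq]; exact_mod_cast h3
  rw [h0, Nat.cast_choose_two, h4]
  have h5 := kk_le n hn s t
  have h6 := kk_two n hn s t
  rw [← if_congr h6 rfl rfl]
  generalize kk n s t = k at *
  interval_cases k <;> simp <;> ring_nf <;> simp

lemma ite_sum_eq (n : ℕ) (s : Faces n) (F : Faces n → ℝ) :
    ∑ t : Faces n, F t * (if s = t then 1 else 0) = F s := by
  simp

lemma sum_N (n : ℕ) (hn : 4 ≤ n) (s : Faces n) :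
    ∑ t : Faces n, (M n * (M n)ᵀ) s t
      = ((n : ℝ) - 3) * (n - 4) / 2 * ((n + 1) * n / 2) + (n - 3) * (2 * n) + 1 := by
  simp_rw [N_eq n hn]
  rw [Finset.sum_add_distrib, Finset.sum_add_distrib, ← Finset.mul_sum, sum_kk n hn,
    ← sum_one n hn, Finset.mul_sum]
  simp

lemma sum_kN (n : ℕ) (hn : 4 ≤ n) (s r : Faces n) :
    ∑ t : Faces n, (kk n r t : ℝ) * (M n * (M n)ᵀ) s t
      = ((n : ℝ) - 3) * (n - 4) / 2 * (2 * n) + (n - 3) * (4 + (n - 1) * kk n s r) + kk n s r := by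
  simp_rw [N_eq n hn]
  rw [← sum_kkkk n hn s r, ← sum_kk n hn r, kk_comm n s r,
    ← ite_sum_eq n s (fun t => (kk n r t : ℝ)), Finset.mul_sum, Finset.mul_sum,
    ← Finset.sum_add_distrib, ← Finset.sum_add_distrib]
  apply Finset.sum_congr rfl
  intro t _
  ring

lemma sum_X1 (n : ℕ) (hn : 4 ≤ n) (s₀ : Faces n) (F : Faces n → ℝ) :
    ∑ t ∈ classes n s₀ 1, F t = ∑ t, (kk n s₀ t : ℝ) * F t - 2 * F s₀ := by
  rw [← ite_sum_eq n s₀ F, Finset.mul_sum, ← Finset.sum_sub_distrib]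
  simp only [classes]
  rw [Finset.sum_filter]
  apply Finset.sum_congr rfl
  intro t _
  have h3 := kk_inter n hn t s₀
  have h5 := kk_le n hn s₀ t
  have h6 := kk_two n hn s₀ t
  rw [kk_comm] at h3
  have h7 : (t.val ∩ s₀.val).card = n - 2 ↔ kk n s₀ t = 1 := by omega
  rw [if_congr h7 rfl rfl, ← if_congr h6 rfl rfl]
  generalize kk n s₀ t = k at *
  interval_cases k <;> norm_num

lemma sum_X2 (n : ℕ) (hn : 4 ≤ n) (s₀ : Faces n) (F : Faces n → ℝ) :
    ∑ t ∈ classes n s₀ 2, F t = ∑ t, F t - ∑ t, (kk n s₀ t : ℝ) * F t + F s₀ := by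
  rw [← ite_sum_eq n s₀ F, ← Finset.sum_sub_distrib, ← Finset.sum_add_distrib]
  simp only [classes]
  rw [Finset.sum_filter]
  apply Finset.sum_congr rfl
  intro t _
  have h3 := kk_inter n hn t s₀
  have h5 := kk_le n hn s₀ t
  have h6 := kk_two n hn s₀ t
  rw [kk_comm] at h3
  have h7 : (t.val ∩ s₀.val).card = n - 3 ↔ kk n s₀ t = 0 := by omega
  rw [if_congr h7 rfl rfl, ← if_congr h6 rfl rfl]
  generalize kk n s₀ t = k at *
  interval_cases k <;> norm_num <;> ring

lemma class_kk (n : ℕ) (hn : 4 ≤ n) (s₀ : Faces n) (i : Fin 3) (s : Faces n)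
    (hs : s ∈ classes n s₀ i) : kk n s s₀ + i.val = 2 := by
  have h3 := kk_inter n hn s s₀
  fin_cases i
  · simp [classes] at hs
    subst hs
    simpa using kk_self n hn s
  · simp [classes] at hs
    simp; omega
  · simp [classes] at hs
    simp; omega

/-- For every `n ≥ 4`, every fixed (n-1)-element subset `s₀` of `Fin (n+1)`,
all `i j : Fin 3` and every `s` in the class `X i` (relative to `s₀`), the row
sum `∑_{t ∈ X j} N s t` of `N = M * Mᵀ` equals `D i j`: the matrix `D` is a
front divisor of the weighted graph with adjacency matrix `N`. -/
theorem frontDivisor_D (n : ℕ) (hn : 4 ≤ n) (s₀ : Faces n) (i j : Fin 3)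
    (s : Faces n) (hs : s ∈ classes n s₀ i) :
    ∑ t ∈ classes n s₀ j, (M n * (M n)ᵀ) s t = ((D n i j : ℚ) : ℝ) := by
  have hk := class_kk n hn s₀ i s hs
  have hN : (M n * (M n)ᵀ) s s₀ = ((n : ℝ) - 3) * (n - 4) / 2 + (n - 3) * kk n s s₀
      + (if kk n s s₀ = 2 then 1 else 0) := by
    rw [N_eq n hn, if_congr (kk_two n hn s s₀) rfl rfl]
  have hj0 : ∑ t ∈ classes n s₀ 0, (M n * (M n)ᵀ) s t = (M n * (M n)ᵀ) s s₀ := by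
    simp [classes]
  have hj1 := sum_X1 n hn s₀ (fun t => (M n * (M n)ᵀ) s t)
  have hj2 := sum_X2 n hn s₀ (fun t => (M n * (M n)ᵀ) s t)
  simp only [sum_N n hn, sum_kN n hn] at hj1 hj2
  rw [hN] at hj0 hj1 hj2
  generalize kk n s s₀ = k at *
  fin_cases i
  · obtain rfl : k = 2 := by simpa using hk
    fin_cases j
    · refine hj0.trans ?_
      simp [D]; ring
    · refine hj1.trans ?_
      simp [D]; ring
    · refine hj2.trans ?_
      simp [D]; ring
  · obtain rfl : k = 1 := by simpa using hk
    fin_cases j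
    · refine hj0.trans ?_
      simp [D]; ring
    · refine hj1.trans ?_
      simp [D]; ring
    · refine hj2.trans ?_
      simp [D]; ring
  · obtain rfl : k = 0 := by simpa using hk
    fin_cases j
    · refine hj0.trans ?_
      simp [D]; ring
    · refine hj1.trans ?_
      simp [D]; ring
    · refine hj2.trans ?_
      simp [D]; ring
end
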